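/- arXiv:1807.07189 — 4 statements merged into one kernel-verified Lean document; each statement's English description precedes it below -/
import Mathlib

section
/- Let H = (X ⊔ W, 𝓔) be a bipartite hypergraph (i.e., every hyperedge e ∈ 𝓔 satisfies |e ∩ X| = 1) in which every hyperedge has at most r elements. Then either H contains a left-perfect matching (a collection of pairwise disjoint hyperedges covering every node of X), or there exist subsets C ⊆ X and U ⊆ W such that every hyperedge incident to a node of C intersects U and |U| ≤ (2r − 3)·(|C| − 1). -/
/-- `M` is a matching of the nodes in `D`. -/
def HaxMatch {X W : Type*} (Ed : X → Finset W → Prop) (D : Finset X) (M : X → Finset W) : Prop :=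
  (∀ x ∈ D, Ed x (M x)) ∧ ∀ x ∈ D, ∀ y ∈ D, x ≠ y → Disjoint (M x) (M y)

theorem hax_card {X W : Type*} [DecidableEq W] [DecidableEq X] (k : ℕ) (e : Finset W)
    (he : e.card ≤ k) (M : X → Finset W) (B : Finset X) (hB : ∀ y ∈ B, (M y).card ≤ k)
    (hB' : ∀ y ∈ B, ¬ Disjoint (M y) e) :
    ((e ∪ B.biUnion M).card : ℤ) ≤ k + B.card * ((k : ℤ) - 1) := by
  induction B using Finset.induction_on with
  | empty => simpa using he
  | insert b B hb ih =>
    have ih := ih (fun y hy => hB y (Finset.mem_insert_of_mem hy))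
      (fun y hy => hB' y (Finset.mem_insert_of_mem hy))
    have h1 := hB b (Finset.mem_insert_self _ _)
    have h2 := hB' b (Finset.mem_insert_self _ _)
    have h3 : e ∪ (insert b B).biUnion M = (e ∪ B.biUnion M) ∪ (M b \ e) := by
      ext w
      simp only [Finset.mem_union, Finset.mem_biUnion, Finset.mem_insert, Finset.mem_sdiff,
        exists_eq_or_imp]
      by_cases hw : w ∈ e <;> simp [hw, or_comm]
    have h4 := Finset.card_union_le (e ∪ B.biUnion M) (M b \ e)
    have h5 := Finset.card_sdiff_add_card_inter (M b) e
    have h6 : 0 < (M b ∩ e).card := by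
      rw [Finset.card_pos, ← Finset.not_disjoint_iff_nonempty_inter]
      exact h2
    rw [h3, Finset.card_insert_of_notMem hb]
    push_cast
    have : ((M b \ e).card : ℤ) ≤ k - 1 := by omega
    have h4' : (((e ∪ B.biUnion M) ∪ (M b \ e)).card : ℤ) ≤
      (e ∪ B.biUnion M).card + (M b \ e).card := by exact_mod_cast h4
    linarith

theorem hax_main {X W : Type*} [DecidableEq W] [DecidableEq X] (k : ℕ) (hk : 1 ≤ k)
    (Ed : X → Finset W → Prop) (hEd : ∀ x a, Ed x a → a.card ≤ k)
    (hno : ∀ (C : Finset X) (U : Finset W), (∀ x ∈ C, ∀ a, Ed x a → ¬ Disjoint a U) →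
      (2 * (k : ℤ) - 1) * ((C.card : ℤ) - 1) < U.card)
    (D : Finset X) (x0 : X) (hx0 : x0 ∉ D) (n : ℕ) :
    ∀ (C : Finset X) (U : Finset W) (M : X → Finset W), D.card + 1 - C.card ≤ n →
      C ⊆ insert x0 D → HaxMatch Ed D M → (∀ y ∈ C, y ∈ D → M y ⊆ U) →
      (U.card : ℤ) ≤ (2 * (k : ℤ) - 1) * ((C.card : ℤ) - 1) →
      ∃ M' x e, HaxMatch Ed D M' ∧ x ∈ C ∧ Ed x e ∧ Disjoint e U ∧ (∀ y ∈ D, Disjoint (M' y) e) ∧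
        (∀ y ∈ C, y ∈ D → M' y = M y) ∧ (∀ y ∈ D, M' y = M y ∨ Disjoint (M' y) U) := by
  classical
  induction n with
  | zero =>
    intro C U M hn hC hM hU hcard
    -- all nodes are in `C`
    have hCeq : C = insert x0 D := by
      apply Finset.eq_of_subset_of_card_le hC
      rw [Finset.card_insert_of_notMem hx0]; omega
    have : ¬ (∀ x ∈ C, ∀ a, Ed x a → ¬ Disjoint a U) := fun h => by
      have := hno C U h; linarith
    push Not at this
    obtain ⟨x, hx, e, he, hd⟩ := this
    refine ⟨M, x, e, hM, hx, he, hd, ?_, fun _ _ _ => rfl, fun _ _ => Or.inl rfl⟩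
    intro y hy
    exact (hd.mono_right (hU y (hCeq ▸ Finset.mem_insert_of_mem hy) hy)).symm
  | succ n ihn =>
    intro C U M hn hC hM hU hcard
    have : ¬ (∀ x ∈ C, ∀ a, Ed x a → ¬ Disjoint a U) := fun h => by
      have := hno C U h; linarith
    push Not at this
    obtain ⟨x, hx, e, he, hd⟩ := this
    -- induction on the number of blocking edges
    obtain ⟨b, hb⟩ : ∃ b, (D.filter (fun y => ¬ Disjoint (M y) e)).card ≤ b := ⟨_, le_rfl⟩
    induction b generalizing M with
    | zero =>
      refine ⟨M, x, e, hM, hx, he, hd, ?_, fun _ _ _ => rfl, fun _ _ => Or.inl rfl⟩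
      intro y hy
      by_contra hcon
      have : y ∈ D.filter (fun y => ¬ Disjoint (M y) e) := Finset.mem_filter.2 ⟨hy, hcon⟩
      have := Finset.card_pos.2 ⟨y, this⟩
      omega
    | succ b ihb =>
      set B := D.filter (fun y => ¬ Disjoint (M y) e) with hBdef
      by_cases hB0 : B.card = 0
      · exact ihb M hM hU (by change B.card ≤ b; omega)
      have hBD : B ⊆ D := Finset.filter_subset _ _
      have hBe : ∀ y ∈ B, ¬ Disjoint (M y) e := fun y hy => (Finset.mem_filter.1 hy).2
      have hCB : Disjoint C B := by
        rw [Finset.disjoint_left]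
        intro y hyC hyB
        exact hBe y hyB (hd.mono_right (hU y hyC (hBD hyB))).symm
      have hcC : (C ∪ B).card = C.card + B.card := Finset.card_union_of_disjoint hCB
      have hCB' : C ∪ B ⊆ insert x0 D :=
        Finset.union_subset hC (hBD.trans (Finset.subset_insert _ _))
      have hle := Finset.card_le_card hCB'
      rw [Finset.card_insert_of_notMem hx0] at hle
      have hcU : ((U ∪ (e ∪ B.biUnion M)).card : ℤ) ≤
          (2 * (k : ℤ) - 1) * (((C ∪ B).card : ℤ) - 1) := by
        have h1 := hax_card k e (hEd x e he) M B (fun y hy => hEd _ _ (hM.1 y (hBD hy))) hBe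
        have h2 : ((U ∪ (e ∪ B.biUnion M)).card : ℤ) ≤ U.card + (e ∪ B.biUnion M).card := by
          exact_mod_cast Finset.card_union_le _ _
        rw [hcC]; push_cast
        have h3 : (1 : ℤ) ≤ B.card := by omega
        have h4 : (1 : ℤ) ≤ k := by exact_mod_cast hk
        nlinarith
      obtain ⟨M', x', e', hM', hx', he', hd', hfree, hagree, hor⟩ :=
        ihn (C ∪ B) (U ∪ (e ∪ B.biUnion M)) M (by omega) hCB' hM (by
          intro y hy hyD
          rcases Finset.mem_union.1 hy with h | h
          · exact (hU y h hyD).trans Finset.subset_union_left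
          · exact (Finset.subset_biUnion_of_mem M h).trans
              (Finset.subset_union_right.trans Finset.subset_union_right)) hcU
      have hdU : Disjoint e' U := hd'.mono_right Finset.subset_union_left
      have hde : Disjoint e' e :=
        hd'.mono_right (Finset.subset_union_left.trans Finset.subset_union_right)
      have hor' : ∀ y ∈ D, M' y = M y ∨ (Disjoint (M' y) U ∧ Disjoint (M' y) e) := by
        intro y hy
        rcases hor y hy with h | h
        · exact Or.inl h
        · exact Or.inr ⟨h.mono_right Finset.subset_union_left,
            h.mono_right (Finset.subset_union_left.trans Finset.subset_union_right)⟩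
      by_cases hxC : x' ∈ C
      · refine ⟨M', x', e', hM', hxC, he', hdU, hfree, ?_, ?_⟩
        · intro y hy hyD
          exact hagree y (Finset.mem_union_left _ hy) hyD
        · intro y hy
          exact (hor' y hy).imp id And.left
      have hxB : x' ∈ B := (Finset.mem_union.1 hx').resolve_left hxC
      have hne : ∀ y ∈ C, y ≠ x' := fun y hy h => hxC (h ▸ hy)
      -- swap
      have hM2 : HaxMatch Ed D (Function.update M' x' e') := by
        constructor
        · intro y hy
          by_cases h : y = x'
          · subst h; simpa using he'
          · simpa [h] using hM'.1 y hy
        · intro y hy z hz hyz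
          by_cases h : y = x'
          · subst h
            simpa [hyz.symm] using (hfree z hz).symm
          · by_cases h' : z = x'
            · subst h'
              simpa [h] using hfree y hy
            · simpa [h, h'] using hM'.2 y hy z hz hyz
      obtain ⟨M3, x3, e3, a1, a2, a3, a4, a5, a6, a7⟩ := ihb (Function.update M' x' e') hM2 (by
          intro y hy hyD
          rw [Function.update_of_ne (hne y hy), hagree y (Finset.mem_union_left _ hy) hyD]
          exact hU y hy hyD) (by
          have : D.filter (fun y => ¬ Disjoint (Function.update M' x' e' y) e) ⊆ B.erase x' := by
            intro y hy
            obtain ⟨hyD, hy⟩ := Finset.mem_filter.1 hy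
            by_cases h : y = x'
            · subst h
              simp [hde] at hy
            · rw [Function.update_of_ne h] at hy
              rcases hor' y hyD with h1 | h1
              · rw [h1] at hy
                exact Finset.mem_erase.2 ⟨h, Finset.mem_filter.2 ⟨hyD, hy⟩⟩
              · exact absurd h1.2 hy
          have := Finset.card_le_card this
          rw [Finset.card_erase_of_mem hxB] at this
          omega)
      refine ⟨M3, x3, e3, a1, a2, a3, a4, a5, ?_, ?_⟩
      · intro y hy hyD
        rw [a6 y hy hyD, Function.update_of_ne (hne y hy),
          hagree y (Finset.mem_union_left _ hy) hyD]
      · intro y hy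
        rcases a7 y hy with h | h
        · by_cases h' : y = x'
          · subst h'
            right; rw [h]; simpa using hdU
          · rw [Function.update_of_ne h'] at h
            rw [h]
            exact (hor' y hy).imp id And.left
        · exact Or.inr h

theorem hax_exists {X W : Type*} [DecidableEq W] [DecidableEq X] (k : ℕ) (hk : 1 ≤ k)
    (Ed : X → Finset W → Prop) (hEd : ∀ x a, Ed x a → a.card ≤ k)
    (hno : ∀ (C : Finset X) (U : Finset W), (∀ x ∈ C, ∀ a, Ed x a → ¬ Disjoint a U) →
      (2 * (k : ℤ) - 1) * ((C.card : ℤ) - 1) < U.card)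
    (D : Finset X) : ∃ M, HaxMatch Ed D M := by
  induction D using Finset.induction_on with
  | empty => exact ⟨fun _ => ∅, by simp [HaxMatch]⟩
  | insert x0 D hx0 ih =>
    obtain ⟨M, hM⟩ := ih
    obtain ⟨M', x, e, hM', hx, he, -, hfree, -, -⟩ :=
      hax_main k hk Ed hEd hno D x0 hx0 _ {x0} ∅ M le_rfl (by simp) hM
        (by intro y hy hyD; rw [Finset.mem_singleton] at hy; subst hy; exact absurd hyD hx0)
        (by simp)
    rw [Finset.mem_singleton] at hx
    subst hx
    have hne : ∀ y ∈ D, y ≠ x := fun y hy h => hx0 (h ▸ hy)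
    refine ⟨Function.update M' x e, ?_, ?_⟩
    · intro y hy
      rcases Finset.mem_insert.1 hy with rfl | hy
      · simpa using he
      · simpa [hne y hy] using hM'.1 y hy
    · intro y hy z hz hyz
      rcases Finset.mem_insert.1 hy with rfl | hy
      · rcases Finset.mem_insert.1 hz with rfl | hz
        · exact absurd rfl hyz
        · simpa [hyz.symm] using (hfree z hz).symm
      · rcases Finset.mem_insert.1 hz with rfl | hz
        · simpa [hyz] using hfree y (by assumption)
        · simpa [hne y hy, hne z hz] using hM'.2 y hy z hz hyz


/-- Haxell's theorem: in a bipartite hypergraph on parts `X` and `W` (every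
hyperedge contains exactly one node of `X`) whose hyperedges have at most `r`
elements, either there is a left-perfect matching, or there are sets `C ⊆ X`
and `U ⊆ W` such that every hyperedge incident to `C` intersects `U` and
`|U| ≤ (2r − 3)(|C| − 1)`. -/
theorem haxell_hypergraph_matching {X W : Type*} [Fintype X] [Fintype W]
    [DecidableEq X] [DecidableEq W]
    (r : ℕ) (hr : 2 ≤ r)
    (E : Finset (Finset (X ⊕ W)))
    (hbip : ∀ e ∈ E, (e.filter (fun v => v.isLeft)).card = 1)
    (hsize : ∀ e ∈ E, e.card ≤ r) :
    (∃ F ⊆ E, (∀ e ∈ F, ∀ e' ∈ F, e ≠ e' → Disjoint e e') ∧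
      ∀ x : X, ∃ e ∈ F, Sum.inl x ∈ e) ∨
    (∃ (C : Finset X) (U : Finset W),
      (∀ e ∈ E, (∃ i ∈ C, Sum.inl i ∈ e) → ∃ w ∈ U, Sum.inr w ∈ e) ∧
      (U.card : ℤ) ≤ (2 * (r : ℤ) - 3) * ((C.card : ℤ) - 1)) := by

  classical
  by_contra hcon
  push Not at hcon
  obtain ⟨hA, hB⟩ := hcon
  obtain ⟨k, rfl⟩ : ∃ k, r = k + 1 := ⟨r - 1, by omega⟩
  have hform : ∀ e ∈ E, ∀ i, Sum.inl i ∈ e → e = ({i} : Finset X).disjSum e.toRight := by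
    intro e he i hi
    obtain ⟨v, hv⟩ := Finset.card_eq_one.1 (hbip e he)
    have hiv : Sum.inl i = v := by
      rw [← Finset.mem_singleton, ← hv]; simp [hi]
    subst hiv
    ext z
    rcases z with x | w
    · have : Sum.inl x ∈ e.filter (fun v => v.isLeft) ↔ Sum.inl x ∈ e := by simp
      rw [← this, hv]; simp
    · simp
  obtain ⟨M, hM1, hM2⟩ := hax_exists k (by omega)
    (fun (x : X) (a : Finset W) => ({x} : Finset X).disjSum a ∈ E)
    (by
      intro x a h
      have := hsize _ h
      rw [Finset.card_disjSum] at this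
      simp at this
      omega)
    (by
      intro C U h
      have := hB C U (by
        rintro e he ⟨i, hi, hie⟩
        have h1 := hform e he i hie
        have h2 := h i hi e.toRight (h1 ▸ he)
        rw [Finset.not_disjoint_iff] at h2
        obtain ⟨w, hw, hwU⟩ := h2
        exact ⟨w, hwU, Finset.mem_toRight.1 hw⟩)
      push_cast at this
      linarith) Finset.univ
  obtain ⟨x, hx⟩ := hA (Finset.univ.image fun x => ({x} : Finset X).disjSum (M x))
    (by
      intro e he
      obtain ⟨x, -, rfl⟩ := Finset.mem_image.1 he
      exact hM1 x (Finset.mem_univ x))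
    (by
      intro e he e' he' hne
      obtain ⟨x, -, rfl⟩ := Finset.mem_image.1 he
      obtain ⟨y, -, rfl⟩ := Finset.mem_image.1 he'
      have hxy : x ≠ y := fun h => hne (by rw [h])
      have hd := hM2 x (Finset.mem_univ x) y (Finset.mem_univ y) hxy
      rw [Finset.disjoint_left] at hd ⊢
      rintro (z | w) h1 h2
      · simp at h1 h2
        exact hxy (h1.symm.trans h2)
      · simp at h1 h2
        exact hd h1 h2)
  exact hx _ (Finset.mem_image_of_mem _ (Finset.mem_univ x)) (by simp)
end

section
/- (Exchange Lemma) For any matroid 𝓜 = (X, 𝓘) and independent sets Y, Z ∈ 𝓘 with |Y| ≤ |Z|, there exists an injection f : Y → Z such that f(i) = i for every i ∈ Y ∩ Z, and for every i ∈ Y \ Z the set (Y \ {i}) ∪ {f(i)} is independent. -/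
theorem exchange_aux {X : Type*} [DecidableEq X]
    (Indep : Finset X → Prop)
    (h_exch : ∀ ⦃Y Z : Finset X⦄, Indep Y → Indep Z → Y.card < Z.card →
      ∃ z ∈ Z, z ∉ Y ∧ Indep (insert z Y))
    (Y : Finset X) (hY : Indep Y) (z : X) (hz : z ∉ Y) (n : ℕ) :
    ∀ S : Finset X, S ⊆ Y → S.card = n + 1 → Indep (insert z (Y \ S)) →
      ∃ i ∈ S, Indep (insert z (Y.erase i)) := by
  induction n with
  | zero =>
    intro S _ hc hI
    obtain ⟨i, rfl⟩ := Finset.card_eq_one.1 hc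
    exact ⟨i, by simp, by rwa [Finset.erase_eq]⟩
  | succ n ih =>
    intro S hS hc hI
    have h1 : (insert z (Y \ S)).card < Y.card := by
      rw [Finset.card_insert_of_notMem (by simp [hz]), Finset.card_sdiff_of_subset hS]
      have := Finset.card_le_card hS
      omega
    obtain ⟨y, hyY, hy, hI'⟩ := h_exch hI hY h1
    have hyS : y ∈ S := by
      by_contra h
      exact hy (by simp [hyY, h])
    obtain ⟨i, hi, hi'⟩ := ih (S.erase y) ((Finset.erase_subset _ _).trans hS)
      (by rw [Finset.card_erase_of_mem hyS]; omega)
      (by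
        convert hI' using 1
        ext x
        by_cases hx : x = y
        · subst hx; simp [hyY]
        · simp [hx])
    exact ⟨i, Finset.mem_of_mem_erase hi, hi'⟩

/-- Exchange Lemma: for a matroid with independence family `Indep` and
independent sets `Y`, `Z` with `|Y| ≤ |Z|`, there is an injection `f : Y → Z`
fixing `Y ∩ Z` pointwise such that for every `i ∈ Y \ Z` the set
`(Y \ {i}) ∪ {f i}` is independent. -/
theorem exchange_lemma {X : Type*} [DecidableEq X] [Fintype X]
    (Indep : Finset X → Prop)
    (h_empty : Indep ∅)
    (h_mono : ∀ ⦃Y Z : Finset X⦄, Z ⊆ Y → Indep Y → Indep Z)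
    (h_exch : ∀ ⦃Y Z : Finset X⦄, Indep Y → Indep Z → Y.card < Z.card →
      ∃ z ∈ Z, z ∉ Y ∧ Indep (insert z Y))
    (Y Z : Finset X) (hY : Indep Y) (hZ : Indep Z) (hcard : Y.card ≤ Z.card) :
    ∃ f : X → X, Set.InjOn f ↑Y ∧ (∀ i ∈ Y, f i ∈ Z) ∧
      (∀ i ∈ Y, i ∈ Z → f i = i) ∧
      (∀ i ∈ Y, i ∉ Z → Indep (insert (f i) (Y.erase i))) := by
  classical
  let t : {i // i ∈ Y \ Z} → Finset X := fun i =>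
    (Z \ Y).filter fun j => Indep (insert j (Y.erase i.1))
  have hall : ∀ s : Finset {i // i ∈ Y \ Z}, s.card ≤ (s.biUnion t).card := by
    intro s
    by_contra! hlt
    let S : Finset X := s.map (Function.Embedding.subtype _)
    have hSc : S.card = s.card := Finset.card_map _
    have hS : ∀ x ∈ S, x ∈ Y ∧ x ∉ Z := by
      intro x hx
      obtain ⟨a, -, rfl⟩ := Finset.mem_map.1 hx
      exact Finset.mem_sdiff.1 a.2
    have hSY : S ⊆ Y := fun x hx => (hS x hx).1
    have hc : (Y \ S).card < (Z \ s.biUnion t).card := by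
      rw [Finset.card_sdiff_of_subset hSY]
      have h1 := Finset.le_card_sdiff (s.biUnion t) Z
      have h2 := Finset.card_le_card hSY
      omega
    obtain ⟨z, hz, hzY, hI⟩ := h_exch (h_mono Finset.sdiff_subset hY)
      (h_mono Finset.sdiff_subset hZ) hc
    rw [Finset.mem_sdiff] at hz
    have hzY' : z ∉ Y := by
      intro h
      exact hzY (Finset.mem_sdiff.2 ⟨h, fun h' => (hS z h').2 hz.1⟩)
    obtain ⟨i, hi, hi'⟩ := exchange_aux Indep h_exch Y hY z hzY' (S.card - 1) S hSY
      (by omega) hI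
    obtain ⟨a, ha, rfl⟩ := Finset.mem_map.1 hi
    exact hz.2 (Finset.mem_biUnion.2 ⟨a, ha,
      Finset.mem_filter.2 ⟨Finset.mem_sdiff.2 ⟨hz.1, hzY'⟩, hi'⟩⟩)
  obtain ⟨g, hg, hgt⟩ := (Finset.all_card_le_biUnion_card_iff_exists_injective t).1 hall
  have hgt' : ∀ a, (g a ∈ Z ∧ g a ∉ Y) ∧ Indep (insert (g a) (Y.erase a.1)) := by
    intro a
    have := Finset.mem_filter.1 (hgt a)
    exact ⟨Finset.mem_sdiff.1 this.1, this.2⟩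
  let f : X → X := fun i => if h : i ∈ Y \ Z then g ⟨i, h⟩ else i
  have f1 : ∀ i (h : i ∈ Y \ Z), f i = g ⟨i, h⟩ := fun i h => dif_pos h
  have f2 : ∀ i, i ∉ Y \ Z → f i = i := fun i h => dif_neg h
  refine ⟨f, ?_, ?_, ?_, ?_⟩
  · intro i hi j hj hij
    by_cases h1 : i ∈ Y \ Z <;> by_cases h2 : j ∈ Y \ Z
    · rw [f1 i h1, f1 j h2] at hij
      exact congrArg Subtype.val (hg hij)
    · rw [f1 i h1, f2 j h2] at hij
      exact absurd (hij ▸ hj) (hgt' ⟨i, h1⟩).1.2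
    · rw [f2 i h1, f1 j h2] at hij
      exact absurd (hij ▸ hi) (hgt' ⟨j, h2⟩).1.2
    · rwa [f2 i h1, f2 j h2] at hij
  · intro i hi
    by_cases h : i ∈ Y \ Z
    · rw [f1 i h]; exact (hgt' _).1.1
    · rw [f2 i h]
      by_contra h'
      exact h (Finset.mem_sdiff.2 ⟨hi, h'⟩)
  · intro i _ hiZ
    exact f2 i fun h => (Finset.mem_sdiff.1 h).2 hiZ
  · intro i hi hiZ
    rw [f1 i (Finset.mem_sdiff.2 ⟨hi, hiZ⟩)]
    exact (hgt' ⟨i, _⟩).2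
end

section
/- Let B₀, B₁, …, B_ℓ be pairwise disjoint finite sets and let C' ⊆ B₀ ∪ ⋯ ∪ B_ℓ. Suppose there is a constant c > 0 such that |C'| ≥ c·|B_{≤ℓ}| and |B_{i+1}| ≥ c·|B_{≤i}| for every i = 0, …, ℓ−1, where B_{≤i} := B₀ ∪ ⋯ ∪ B_i. Then, with k the least nonnegative integer such that c·(1+c)^k ≥ 2 and γ := 1/(2(k+1)), there exists an index 0 ≤ ℓ̃ ≤ ℓ such that |C' ∩ B_{ℓ̃}| ≥ γ·|C'|. -/
/-- Lemma: if `C'` is a constant fraction of the union of the layers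
`B 0, …, B ℓ`, and each layer is at least a constant fraction of the union of
the previous layers, then some single layer contains a constant fraction
(namely `1/(2(k+1))`, where `k` is minimal with `c(1+c)^k ≥ 2`) of `C'`. -/
theorem constant_size_swap {α : Type*} [DecidableEq α] (ℓ : ℕ) (B : ℕ → Finset α)
    (hdisj : ∀ i ≤ ℓ, ∀ j ≤ ℓ, i ≠ j → Disjoint (B i) (B j))
    (C' : Finset α) (hC'sub : C' ⊆ (Finset.range (ℓ + 1)).biUnion B)
    (c : ℝ) (hc : 0 < c)
    (hC'card : c * (((Finset.range (ℓ + 1)).biUnion B).card : ℝ) ≤ (C'.card : ℝ))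
    (hgrow : ∀ i < ℓ, c * (((Finset.range (i + 1)).biUnion B).card : ℝ) ≤ ((B (i + 1)).card : ℝ))
    (k : ℕ) (hk : 2 ≤ c * (1 + c) ^ k) (hkmin : ∀ k' < k, c * (1 + c) ^ k' < 2) :
    ∃ l ≤ ℓ, (1 / (2 * ((k : ℝ) + 1))) * (C'.card : ℝ) ≤ ((C' ∩ B l).card : ℝ) := by
  by_contra hcon
  push Not at hcon
  set g : ℝ := (1 / (2 * ((k : ℝ) + 1))) * (C'.card : ℝ) with hg
  have hU : ∀ i, (Finset.range (i + 1 + 1)).biUnion B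
      = (Finset.range (i + 1)).biUnion B ∪ B (i + 1) := by
    intro i
    rw [Finset.range_add_one (n := i + 1), Finset.biUnion_insert, Finset.union_comm]
  have hstep : ∀ i < ℓ, (1 + c) * (((Finset.range (i + 1)).biUnion B).card : ℝ)
      ≤ (((Finset.range (i + 1 + 1)).biUnion B).card : ℝ) := by
    intro i hi
    have hd : Disjoint ((Finset.range (i + 1)).biUnion B) (B (i + 1)) := by
      rw [Finset.disjoint_biUnion_left]
      intro j hj
      have hj' := Finset.mem_range.mp hj
      exact hdisj j (by omega) (i + 1) (by omega) (by omega)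
    rw [hU, Finset.card_union_of_disjoint hd]
    push_cast
    linarith [hgrow i hi]
  have hpow : ∀ n j, j + n ≤ ℓ → (1 + c) ^ n * (((Finset.range (j + 1)).biUnion B).card : ℝ)
      ≤ (((Finset.range (j + n + 1)).biUnion B).card : ℝ) := by
    intro n
    induction n with
    | zero => intro j _; simp
    | succ n ih =>
      intro j hj
      have h1 := ih j (by omega)
      have h2 := hstep (j + n) (by omega)
      have h3 := mul_le_mul_of_nonneg_left h1 (by linarith : (0 : ℝ) ≤ 1 + c)
      rw [← add_assoc, pow_succ]
      linarith
  have hCstep : ∀ i < ℓ, ((C' ∩ (Finset.range (i + 1 + 1)).biUnion B).card : ℝ)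
      ≤ ((C' ∩ (Finset.range (i + 1)).biUnion B).card : ℝ) + g := by
    intro i hi
    rw [hU, Finset.inter_union_distrib_left]
    have h1 : ((C' ∩ (Finset.range (i + 1)).biUnion B ∪ C' ∩ B (i + 1)).card : ℝ)
        ≤ ((C' ∩ (Finset.range (i + 1)).biUnion B).card : ℝ) + ((C' ∩ B (i + 1)).card : ℝ) := by
      exact_mod_cast Finset.card_union_le _ _
    linarith [hcon (i + 1) (by omega)]
  have hCn : ∀ n j, j + n ≤ ℓ → ((C' ∩ (Finset.range (j + n + 1)).biUnion B).card : ℝ)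
      ≤ ((C' ∩ (Finset.range (j + 1)).biUnion B).card : ℝ) + n * g := by
    intro n
    induction n with
    | zero => intro j _; simp
    | succ n ih =>
      intro j hj
      have h1 := ih j (by omega)
      have h2 := hCstep (j + n) (by omega)
      rw [← add_assoc]
      push_cast
      linarith
  have hCall : C' ∩ (Finset.range (ℓ + 1)).biUnion B = C' := Finset.inter_eq_left.mpr hC'sub
  have hgpos : 0 < g := lt_of_le_of_lt (Nat.cast_nonneg _) (hcon 0 (Nat.zero_le _))
  have hgk : 2 * (((k : ℝ) + 1) * g) = (C'.card : ℝ) := by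
    rw [hg]
    field_simp
  have hkg : 0 ≤ (k : ℝ) * g := by positivity
  rcases le_total ℓ k with hl | hl
  · have h1 := hCn ℓ 0 (by omega)
    have h0 := hcon 0 (Nat.zero_le _)
    have hB0 : (Finset.range (0 + 1)).biUnion B = B 0 := by simp
    rw [hB0, zero_add, hCall] at h1
    have h2 : (ℓ : ℝ) * g ≤ k * g :=
      mul_le_mul_of_nonneg_right (by exact_mod_cast hl) hgpos.le
    linarith
  · obtain ⟨j, rfl⟩ := Nat.exists_eq_add_of_le' hl
    have h1 := hCn k j le_rfl
    rw [hCall] at h1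
    have h2 := mul_le_mul_of_nonneg_left (hpow k j le_rfl) hc.le
    have h3 := mul_le_mul_of_nonneg_right hk
      (Nat.cast_nonneg (α := ℝ) ((Finset.range (j + 1)).biUnion B).card)
    have h4 : ((C' ∩ (Finset.range (j + 1)).biUnion B).card : ℝ)
        ≤ (((Finset.range (j + 1)).biUnion B).card : ℝ) := by
      exact_mod_cast Finset.card_le_card Finset.inter_subset_right
    linarith
end

section
/- Let M and J_L be finite sets and A_j ⊆ M for each j ∈ J_L. Call a subset M_L ⊆ M matchable if there exists an injection g : M_L → J_L with i ∈ A_{g(i)} for every i ∈ M_L. Suppose z ∈ ℝ^{M×J_L}_{≥0} satisfies z_{ij} = 0 whenever i ∉ A_j, ∑_{i ∈ M} z_{ij} ≤ 1 for every j ∈ J_L, and x_i := ∑_{j ∈ J_L} z_{ij} ≤ 1 for every i ∈ M. Then the vector x = (x_i)_{i ∈ M} lies in the convex hull of the characteristic vectors of the matchable subsets of M. -/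
open Finset

/-- A subset `S` of the children `M` is matchable if there is an injection
`g` from `S` into the large gifts `J_L` with `i ∈ A (g i)` for all `i ∈ S`. -/
def MatchableSet {M JL : Type*} (A : JL → Finset M) (S : Finset M) : Prop :=
  ∃ g : (↑S : Set M) → JL, Function.Injective g ∧ ∀ i : (↑S : Set M), (i : M) ∈ A (g i)

/-- A fractional matching between children and large gifts yields a point
`x i := ∑_j z i j` in the matroid polytope of the matchable set matroid, i.e.
in the convex hull of the characteristic vectors of the matchable subsets. -/
theorem fractional_matching_in_matchable_polytope {M JL : Type*}
    [Fintype M] [Fintype JL] [DecidableEq M]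
    (A : JL → Finset M) (z : M → JL → ℝ)
    (hz0 : ∀ i j, 0 ≤ z i j)
    (hzA : ∀ i j, i ∉ A j → z i j = 0)
    (hcol : ∀ j : JL, ∑ i : M, z i j ≤ 1)
    (hrow : ∀ i : M, ∑ j : JL, z i j ≤ 1) :
    (fun i => ∑ j : JL, z i j) ∈ convexHull ℝ
      {v : M → ℝ | ∃ S : Finset M, MatchableSet A S ∧
        v = fun i => if i ∈ S then (1 : ℝ) else 0} := by
  classical
  let P : Matrix (M ⊕ JL) (M ⊕ JL) ℝ := Matrix.fromBlocks
    (Matrix.diagonal fun i => 1 - ∑ j, z i j) (Matrix.of z)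
    (Matrix.of z).transpose (Matrix.diagonal fun j => 1 - ∑ i, z i j)
  have hP : P ∈ doublyStochastic ℝ (M ⊕ JL) := by
    rw [mem_doublyStochastic_iff_sum]
    refine ⟨?_, ?_, ?_⟩
    · rintro (i | i) (j | j)
      · simp only [P, Matrix.fromBlocks_apply₁₁, Matrix.diagonal_apply]
        split_ifs
        · linarith [hrow i]
        · exact le_rfl
      · simpa [P] using hz0 i j
      · simpa [P] using hz0 j i
      · simp only [P, Matrix.fromBlocks_apply₂₂, Matrix.diagonal_apply]
        split_ifs
        · linarith [hcol i]
        · exact le_rfl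
    · rintro (i | i) <;> simp [P, Matrix.diagonal_apply]
    · rintro (i | i) <;> simp [P, Matrix.diagonal_apply]
  obtain ⟨w, hw0, hw1, hw⟩ := exists_eq_sum_perm_of_mem_doublyStochastic hP
  let S : Equiv.Perm (M ⊕ JL) → Finset M := fun σ =>
    Finset.univ.filter fun i => ∃ j, i ∈ A j ∧ σ (Sum.inl i) = Sum.inr j
  have hz : ∀ i j, z i j = ∑ σ : Equiv.Perm (M ⊕ JL),
      w σ * (if i ∈ A j ∧ σ (Sum.inl i) = Sum.inr j then 1 else 0) := by
    intro i j
    by_cases h : i ∈ A j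
    · have h1 := congrFun (congrFun hw (Sum.inl i)) (Sum.inr j)
      simp only [P, Matrix.fromBlocks_apply₁₂, Matrix.of_apply, Matrix.sum_apply,
        Matrix.smul_apply, Equiv.Perm.permMatrix, PEquiv.toMatrix_apply,
        Equiv.toPEquiv_apply, smul_eq_mul, Option.mem_some_iff] at h1
      simp only [h, true_and]
      exact h1.symm
    · simp [h, hzA i j h]
  have key : (fun i => ∑ j : JL, z i j) = ∑ σ : Equiv.Perm (M ⊕ JL),
      w σ • (fun i => if i ∈ S σ then (1 : ℝ) else 0) := by
    funext i
    simp only [Finset.sum_apply, Pi.smul_apply, smul_eq_mul]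
    rw [Finset.sum_congr rfl fun j _ => hz i j, Finset.sum_comm]
    refine Finset.sum_congr rfl fun σ _ => ?_
    rw [← Finset.mul_sum]
    congr 1
    by_cases h : i ∈ S σ
    · rw [if_pos h]
      obtain ⟨j, hj, hσ⟩ := (Finset.mem_filter.1 h).2
      rw [Finset.sum_eq_single j]
      · simp [hj, hσ]
      · intro k _ hk
        rw [if_neg]
        rintro ⟨_, h2⟩
        exact hk (Sum.inr_injective (h2.symm.trans hσ))
      · simp
    · rw [if_neg h]
      refine Finset.sum_eq_zero fun j _ => if_neg fun hj => h ?_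
      exact Finset.mem_filter.2 ⟨Finset.mem_univ _, j, hj⟩
  rw [key]
  refine (convex_convexHull ℝ _).sum_mem (fun σ _ => hw0 σ) hw1 fun σ _ => ?_
  refine subset_convexHull ℝ _ ⟨S σ, ?_, rfl⟩
  have hS : ∀ i : (↑(S σ) : Set M), ∃ j, (i : M) ∈ A j ∧ σ (Sum.inl (i : M)) = Sum.inr j :=
    fun i => (Finset.mem_filter.1 (Finset.mem_coe.1 i.2)).2
  choose g hgA hg using hS
  refine ⟨g, fun a b hab => ?_, hgA⟩
  apply Subtype.ext
  apply Sum.inl_injective (β := JL)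
  apply σ.injective
  rw [hg, hg, hab]
end
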